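/- (Proposition 2, part 1.) Let γ: ℚ → Σ be a finite piecewise function. For every q that is a convergent fraction of some element of bounds(γ), there exists a break link (p1, p2) of γ such that q ∈ {p1, p2}. -/

import Mathlib

/-- Fractions are pairs `(numerator, denominator)` of integers; `(-1,0)` is `-∞`, `(1,0)` is `∞`. -/
def mediant (p q : ℤ × ℤ) : ℤ × ℤ := (p.1 + q.1, p.2 + q.2)

/-- The Stern–Brocot boundary relation `B`: `SBB l m r` means `(l, m, r) ∈ B`. -/
inductive SBB : ℤ × ℤ → ℤ × ℤ → ℤ × ℤ → Prop
  | base : SBB (-1, 0) (0, 1) (1, 0)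
  | left {l m r : ℤ × ℤ} : SBB l m r → SBB l (mediant l m) m
  | right {l m r : ℤ × ℤ} : SBB l m r → SBB m (mediant m r) r

/-- One step down the Stern–Brocot tree; the state is the triple
(left bound, node, right bound); `false` is an L-move, `true` an R-move. -/
def sbStep : (ℤ × ℤ) × (ℤ × ℤ) × (ℤ × ℤ) → Bool → (ℤ × ℤ) × (ℤ × ℤ) × (ℤ × ℤ)
  | (l, m, _r), false => (l, mediant l m, m)
  | (_l, m, r), true => (m, mediant m r, r)

/-- Boundary triple of the node reached from the root `0/1` by the path `s ∈ {L,R}*`. -/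
def sbTriple (s : List Bool) : (ℤ × ℤ) × (ℤ × ℤ) × (ℤ × ℤ) :=
  s.foldl sbStep ((-1, 0), (0, 1), (1, 0))

/-- The (numerator, denominator) of the node reached by the path `s`. -/
def sbNode (s : List Bool) : ℤ × ℤ := (sbTriple s).2.1

/-- The rational number at the node of the Stern–Brocot tree reached by the path `s`. -/
def sbVal (s : List Bool) : ℚ := ((sbNode s).1 : ℚ) / ((sbNode s).2 : ℚ)

/-- The path (string in {L,R}*) whose run-length encoding is the block list `l`,
the first block being in direction `b` (`true` = R, `false` = L). -/
def pathOf (b : Bool) : List ℕ → List Bool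
  | [] => []
  | a :: rest => List.replicate a b ++ pathOf (!b) rest

/-- `s` is the path of a convergent fraction of the node with path `t`:
either `s = t`, or `s` corresponds to the first `m` blocks (1 ≤ m ≤ n) of the
run-length (SB-)encoding of `t`. -/
def ConvPath (s t : List Bool) : Prop :=
  s = t ∨ ∃ (b : Bool) (l : List ℕ) (m : ℕ),
    (∀ a ∈ l, 0 < a) ∧ 0 < m ∧ m ≤ l.length ∧ t = pathOf b l ∧ s = pathOf b (l.take m)

/-- `s` is the path of a strict convergent fraction of the node with path `t`. -/
def StrictConvPath (s t : List Bool) : Prop :=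
  ∃ (b : Bool) (l : List ℕ) (m : ℕ),
    (∀ a ∈ l, 0 < a) ∧ 0 < m ∧ m < l.length ∧ t = pathOf b l ∧ s = pathOf b (l.take m)

/-- `p` is a convergent fraction of `r` in the Stern–Brocot tree. -/
def ConvOf (p r : ℚ) : Prop := ∃ s t : List Bool, sbVal s = p ∧ sbVal t = r ∧ ConvPath s t

/-- `r` is a (strict) ancestor of `p` in the Stern–Brocot tree, i.e. `p` is a descendant of `r`. -/
def IsAncestor (r p : ℚ) : Prop := ∃ s t : List Bool, sbVal s = r ∧ t ≠ [] ∧ sbVal (s ++ t) = p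

/-- `(p, q)` is an edge of the Stern–Brocot tree, `q` a child of `p`. -/
def IsEdge (p q : ℚ) : Prop := ∃ (s : List Bool) (d : Bool), sbVal s = p ∧ sbVal (s ++ [d]) = q

/-- An interval of `ℚ`: a nonempty order-convex set. -/
def IsInterval (I : Set ℚ) : Prop :=
  I.Nonempty ∧ ∀ p ∈ I, ∀ q ∈ I, ∀ r : ℚ, p < r → r < q → r ∈ I

/-- An interval partition of `ℚ`: a list of intervals, pointwise increasing, covering `ℚ`. -/
def IsIntervalPartition (P : List (Set ℚ)) : Prop :=
  (∀ I ∈ P, IsInterval I) ∧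
  P.Pairwise (fun I J => ∀ p ∈ I, ∀ q ∈ J, p < q) ∧
  (∀ x : ℚ, ∃ I ∈ P, x ∈ I)

/-- `I` is monochromatic with respect to `γ`: `γ` is constant on `I`. -/
def Monochromatic {S : Type*} (γ : ℚ → S) (I : Set ℚ) : Prop :=
  ∀ p ∈ I, ∀ q ∈ I, γ p = γ q

/-- `γ` is a finite piecewise function. -/
def FinitePW {S : Type*} (γ : ℚ → S) : Prop :=
  ∃ P : List (Set ℚ), IsIntervalPartition P ∧ ∀ I ∈ P, Monochromatic γ I

/-- `P` is the canonical representation of `γ`: an interval partition into monochromatic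
pieces on which `γ` takes different constant values on adjacent pieces. -/
def IsCanonicalRep {S : Type*} (γ : ℚ → S) (P : List (Set ℚ)) : Prop :=
  IsIntervalPartition P ∧ (∀ I ∈ P, Monochromatic γ I) ∧
  P.Chain' (fun I J => ∀ p ∈ I, ∀ q ∈ J, γ p ≠ γ q)

/-- `x ∈ bounds(γ)`: `x` is a (rational) infimum or supremum of an interval of the
canonical representation of `γ`. -/
def IsBound {S : Type*} (γ : ℚ → S) (x : ℚ) : Prop :=
  ∃ P, IsCanonicalRep γ P ∧ ∃ I ∈ P, IsGLB I x ∨ IsLUB I x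

/-- `x` is a left-bound of `γ`: the minimum of some interval of the canonical representation. -/
def IsLeftBound {S : Type*} (γ : ℚ → S) (x : ℚ) : Prop :=
  ∃ P, IsCanonicalRep γ P ∧ ∃ I ∈ P, IsLeast I x

/-- `x` is a right-bound of `γ`: the maximum of some interval of the canonical representation. -/
def IsRightBound {S : Type*} (γ : ℚ → S) (x : ℚ) : Prop :=
  ∃ P, IsCanonicalRep γ P ∧ ∃ I ∈ P, IsGreatest I x

/-- `(p, q)` is a break link of `γ`: an edge of the Stern–Brocot tree such that `p = 0/1`
or the unordered closed interval `⟦p, q⟧` is not monochromatic w.r.t. `γ`. -/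
def IsBreakLink {S : Type*} (γ : ℚ → S) (p q : ℚ) : Prop :=
  IsEdge p q ∧ (p = 0 ∨ ¬ Monochromatic γ (Set.uIcc p q))

/-- `cfval [a₁,…,aₙ] = a₁ + 1/(a₂ + 1/(⋯ + 1/(aₙ + 1)))`. -/
def cfval : List ℕ → ℚ
  | [] => 1
  | [a] => (a : ℚ) + 1
  | a :: b :: rest => (a : ℚ) + 1 / cfval (b :: rest)

/-- `FracLT p q` compares fractions by cross-multiplication, so that `(-1, 0)` and `(1, 0)`
behave as `-∞` and `∞`. -/
def FracLT (p q : ℤ × ℤ) : Prop := p.1 * q.2 < q.1 * p.2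

/-- The rational value of a fraction. -/
def fracVal (p : ℤ × ℤ) : ℚ := (p.1 : ℚ) / (p.2 : ℚ)

/-- A boundary triple with nonnegative denominators in increasing order. -/
structure OrderedTriple (T : (ℤ × ℤ) × (ℤ × ℤ) × (ℤ × ℤ)) : Prop where
  left_den : 0 ≤ T.1.2
  node_den : 0 < T.2.1.2
  right_den : 0 ≤ T.2.2.2
  left_lt : FracLT T.1 T.2.1
  lt_right : FracLT T.2.1 T.2.2

theorem fracLT_mediant {p q : ℤ × ℤ} (h : FracLT p q) : FracLT p (mediant p q) := by
  simp only [FracLT, mediant] at *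
  linarith

theorem mediant_fracLT {p q : ℤ × ℤ} (h : FracLT p q) : FracLT (mediant p q) q := by
  simp only [FracLT, mediant] at *
  linarith

theorem fracVal_lt_fracVal {p q : ℤ × ℤ} (hp : 0 < p.2) (hq : 0 < q.2) (h : FracLT p q) :
    fracVal p < fracVal q := by
  have hp' : (0 : ℚ) < p.2 := by exact_mod_cast hp
  have hq' : (0 : ℚ) < q.2 := by exact_mod_cast hq
  rw [fracVal, fracVal, div_lt_div_iff₀ hp' hq']
  exact_mod_cast h

theorem OrderedTriple.sbStep {T : (ℤ × ℤ) × (ℤ × ℤ) × (ℤ × ℤ)} (h : OrderedTriple T)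
    (d : Bool) : OrderedTriple (sbStep T d) := by
  obtain ⟨l, m, r⟩ := T
  obtain ⟨hl, hm, hr, hlm, hmr⟩ := h
  cases d
  · exact ⟨hl, add_pos_of_nonneg_of_pos hl hm, hm.le, fracLT_mediant hlm, mediant_fracLT hlm⟩
  · exact ⟨hm.le, add_pos_of_pos_of_nonneg hm hr, hr, fracLT_mediant hmr, mediant_fracLT hmr⟩

theorem sbTriple_append (s u : List Bool) : sbTriple (s ++ u) = u.foldl sbStep (sbTriple s) :=
  List.foldl_append

theorem orderedTriple_sbTriple (s : List Bool) : OrderedTriple (sbTriple s) := by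
  induction s using List.reverseRecOn with
  | nil => constructor <;> simp [sbTriple, FracLT]
  | append_singleton s d ih =>
    rw [sbTriple_append]
    exact ih.sbStep d

theorem OrderedTriple.foldl_mem_Ioo (u : List Bool) {T : (ℤ × ℤ) × (ℤ × ℤ) × (ℤ × ℤ)}
    (h : OrderedTriple T) (hl : 0 < T.1.2) (hr : 0 < T.2.2.2) :
    fracVal (u.foldl _root_.sbStep T).2.1 ∈ Set.Ioo (fracVal T.1) (fracVal T.2.2) := by
  induction u generalizing T with
  | nil =>
    exact ⟨fracVal_lt_fracVal hl h.node_den h.left_lt,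
      fracVal_lt_fracVal h.node_den hr h.lt_right⟩
  | cons d u ih =>
    have hlm := fracVal_lt_fracVal hl h.node_den h.left_lt
    have hmr := fracVal_lt_fracVal h.node_den hr h.lt_right
    have hd := h.sbStep d
    obtain ⟨l, m, r⟩ := T
    cases d
    · have := ih hd hl h.node_den
      exact ⟨this.1, this.2.trans hmr⟩
    · have := ih hd h.node_den hr
      exact ⟨hlm.trans this.1, this.2⟩

theorem sbVal_append_false_lt (s : List Bool) : sbVal (s ++ [false]) < sbVal s := by
  have h := orderedTriple_sbTriple s
  have h' := (h.sbStep false).node_den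
  rw [sbVal, sbVal, sbNode, sbNode, sbTriple_append]
  exact fracVal_lt_fracVal h' h.node_den (mediant_fracLT h.left_lt)

theorem lt_sbVal_append_true (s : List Bool) : sbVal s < sbVal (s ++ [true]) := by
  have h := orderedTriple_sbTriple s
  have h' := (h.sbStep true).node_den
  rw [sbVal, sbVal, sbNode, sbNode, sbTriple_append]
  exact fracVal_lt_fracVal h.node_den h' (fracLT_mediant h.lt_right)

/-- After a turn in the path, all further nodes lie strictly between the two endpoints of the
edge preceding the turn. -/
theorem sbVal_turn_mem_Ioo (s : List Bool) (d : Bool) (u : List Bool) :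
    sbVal (s ++ d :: (!d) :: u) ∈ Set.Ioo (min (sbVal s) (sbVal (s ++ [d])))
      (max (sbVal s) (sbVal (s ++ [d]))) := by
  have h := orderedTriple_sbTriple s
  have h1 := h.sbStep d
  have h2 := (h1.sbStep (!d))
  cases d
  · rw [min_eq_right (sbVal_append_false_lt s).le, max_eq_left (sbVal_append_false_lt s).le]
    have := h2.foldl_mem_Ioo u h1.node_den h.node_den
    rw [sbVal, sbVal, sbVal, sbNode, sbNode, sbNode, sbTriple_append, sbTriple_append]
    exact this
  · rw [min_eq_left (lt_sbVal_append_true s).le, max_eq_right (lt_sbVal_append_true s).le]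
    have := h2.foldl_mem_Ioo u h.node_den h1.node_den
    rw [sbVal, sbVal, sbVal, sbNode, sbNode, sbNode, sbTriple_append, sbTriple_append]
    exact this

/-- The path of a proper initial segment of blocks ends in a move that is followed by a turn. -/
theorem pathOf_take_turn (l : List ℕ) (b : Bool) (m : ℕ) (hl : ∀ a ∈ l, 0 < a) (hm : 0 < m)
    (hml : m < l.length) :
    ∃ s d u, pathOf b (l.take m) = s ++ [d] ∧ pathOf b l = s ++ d :: (!d) :: u := by
  induction l generalizing b m with
  | nil => simp at hml
  | cons a l ih =>
    obtain _ | _ | m := m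
    · omega
    · obtain _ | ⟨c, l⟩ := l
      · simp at hml
      obtain ⟨a, rfl⟩ := Nat.exists_eq_succ_of_ne_zero (hl a (by simp)).ne'
      obtain ⟨c, rfl⟩ := Nat.exists_eq_succ_of_ne_zero (hl c (by simp)).ne'
      refine ⟨List.replicate a b, b, List.replicate c (!b) ++ pathOf b l, ?_, ?_⟩
      · simp [pathOf, List.replicate_succ']
      · simp only [pathOf, Bool.not_not, Nat.succ_eq_add_one]
        rw [List.replicate_succ', List.replicate_succ]
        simp
    · obtain ⟨s, d, u, h1, h2⟩ := ih (!b) (m + 1) (fun x hx => hl x (by simp [hx])) (by omega)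
        (by simpa using hml)
      refine ⟨List.replicate a b ++ s, d, u, ?_, ?_⟩
      · rw [List.take_succ_cons, pathOf, h1, List.append_assoc]
      · rw [pathOf, h2, List.append_assoc]

theorem IsCanonicalRep.not_monochromatic {S : Type*} {γ : ℚ → S} {P : List (Set ℚ)}
    (hP : IsCanonicalRep γ P) {A B : Set ℚ} (hA : A ∈ P) (hB : B ∈ P) (hAB : A ≠ B)
    {a b : ℚ} (ha : a ∈ A) (hb : b ∈ B) (hab : a < b) :
    ¬ Monochromatic γ (Set.Icc a b) := by
  intro hmono
  obtain ⟨⟨hint, hpw, -⟩, -, hch⟩ := hP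
  rw [List.pairwise_iff_getElem] at hpw
  obtain ⟨i, hi, rfl⟩ := List.getElem_of_mem hA
  obtain ⟨j, hj, rfl⟩ := List.getElem_of_mem hB
  obtain hij | rfl | hij := lt_trichotomy i j
  · have hi1 : i + 1 < P.length := by omega
    have hne := List.isChain_iff_getElem.1 hch i hi1
    obtain ⟨w, hw, hwb⟩ : ∃ w ∈ P[i + 1], w ≤ b := by
      obtain h | h := (Nat.succ_le_of_lt hij).eq_or_lt
      · subst h
        exact ⟨b, hb, le_rfl⟩
      · obtain ⟨w, hw⟩ := (hint _ (List.getElem_mem hi1)).1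
        exact ⟨w, hw, (hpw _ _ hi1 hj h w hw b hb).le⟩
    have haw := hpw _ _ hi hi1 (Nat.lt_succ_self i) a ha w hw
    exact hne a ha w hw (hmono a ⟨le_rfl, hab.le⟩ w ⟨haw.le, hwb⟩)
  · exact hAB rfl
  · exact (hpw _ _ hj hi hij b hb a ha).not_gt hab

theorem Monochromatic.mono {S : Type*} {γ : ℚ → S} {I J : Set ℚ} (h : Monochromatic γ J)
    (hIJ : I ⊆ J) : Monochromatic γ I :=
  fun p hp q hq => h p (hIJ hp) q (hIJ hq)

theorem IsBound.not_monochromatic {S : Type*} {γ : ℚ → S} {r a b : ℚ} (hr : IsBound γ r)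
    (har : a < r) (hrb : r < b) : ¬ Monochromatic γ (Set.Icc a b) := by
  obtain ⟨P, hP, I, hI, h | h⟩ := hr
  · obtain ⟨y, hy, hry, hyb⟩ := h.exists_between hrb
    obtain ⟨J, hJ, haJ⟩ := hP.1.2.2 a
    have hJI : J ≠ I := fun e => (h.1 (e ▸ haJ)).not_gt har
    exact fun hm => hP.not_monochromatic hJ hI hJI haJ hy (har.trans_le hry)
      (hm.mono (Set.Icc_subset_Icc_right hyb.le))
  · obtain ⟨y, hy, hay, hyr⟩ := h.exists_between har
    obtain ⟨J, hJ, hbJ⟩ := hP.1.2.2 b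
    have hIJ : I ≠ J := fun e => (h.1 (e.symm ▸ hbJ)).not_gt hrb
    exact fun hm => hP.not_monochromatic hI hJ hIJ hy hbJ (hyr.trans_lt hrb)
      (hm.mono (Set.Icc_subset_Icc_left hay.le))

/-- One of the two edges from a bound to its children is a break link. -/
theorem IsBound.exists_isBreakLink_child {S : Type*} {γ : ℚ → S} {s : List Bool}
    (hr : IsBound γ (sbVal s)) : ∃ d, IsBreakLink γ (sbVal s) (sbVal (s ++ [d])) := by
  by_contra! hno
  have hmono (d) : Monochromatic γ (Set.uIcc (sbVal s) (sbVal (s ++ [d]))) := by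
    by_contra h
    exact hno d ⟨⟨s, d, rfl, rfl⟩, Or.inr h⟩
  have hlt := sbVal_append_false_lt s
  have hgt := lt_sbVal_append_true s
  have hval : ∀ p ∈ Set.Icc (sbVal (s ++ [false])) (sbVal (s ++ [true])),
      γ p = γ (sbVal s) := by
    intro p hp
    obtain h | h := le_total p (sbVal s)
    · exact hmono false p (Set.mem_uIcc.2 (Or.inr ⟨hp.1, h⟩)) _ Set.left_mem_uIcc
    · exact hmono true p (Set.mem_uIcc.2 (Or.inl ⟨h, hp.2⟩)) _ Set.left_mem_uIcc
  exact hr.not_monochromatic hlt hgt fun p hp q hq => (hval p hp).trans (hval q hq).symm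

/-- Proposition 2, part 1: for a finite piecewise function `γ : ℚ → Σ`,
every convergent fraction `x` of an element of `bounds(γ)` is an endpoint of some
break link of `γ`. -/
theorem convergent_of_bound_is_break_link_endpoint {S : Type*} [Finite S]
    (γ : ℚ → S) (hγ : FinitePW γ) (x r : ℚ) (hr : IsBound γ r) (hconv : ConvOf x r) :
    ∃ p1 p2 : ℚ, IsBreakLink γ p1 p2 ∧ (x = p1 ∨ x = p2) := by
  obtain ⟨s, t, rfl, rfl, hst⟩ := hconv
  have hself : s = t → ∃ p1 p2 : ℚ, IsBreakLink γ p1 p2 ∧ (sbVal s = p1 ∨ sbVal s = p2) := by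
    rintro rfl
    obtain ⟨d, hd⟩ := hr.exists_isBreakLink_child
    exact ⟨_, _, hd, Or.inl rfl⟩
  obtain h | ⟨b, l, m, hl, hm, hml, ht, hs⟩ := hst
  · exact hself h
  obtain hml | hml := hml.eq_or_lt
  · exact hself (by rw [hs, ht, hml, List.take_length])
  · obtain ⟨s', d, u, h1, h2⟩ := pathOf_take_turn l b m hl hm hml
    rw [ht, h2] at hr
    rw [hs, h1]
    obtain ⟨hlo, hhi⟩ := sbVal_turn_mem_Ioo s' d u
    exact ⟨sbVal s', sbVal (s' ++ [d]),
      ⟨⟨s', d, rfl, rfl⟩, Or.inr (hr.not_monochromatic hlo hhi)⟩, Or.inr rfl⟩
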